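/- If a formula φ(x,y) has the c_κ-tree property for some κ ≥ 2, then φ is unstable (has the order property). Consequently, every theory with c-TP is unstable. -/

import Mathlib

/- Common definitions for formalizing "Tree properties for colored linear orders". -/

open FirstOrder FirstOrder.Language Cardinal

universe u v

namespace PaperTP

/-- Two tuples (possibly in two different structures of the same language) have the same
complete quantifier-free type. -/
def qfTypeEq (L' : FirstOrder.Language.{u, u}) {A : Type u} {B : Type u} [L'.Structure A] [L'.Structure B]
    {n : ℕ} (t : Fin n → A) (s : Fin n → B) : Prop :=
  ∀ φ : L'.Formula (Fin n), BoundedFormula.IsQF φ →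
    (Formula.Realize φ t ↔ Formula.Realize φ s)

/-- An elementary extension of the `L`-structure `M`, bundled. -/
structure ElemExtension (L : FirstOrder.Language.{u, u}) (M : Type u) [L.Structure M] :
    Type (u + 1) where
  carrier : Type u
  str : L.Structure carrier
  emb : @Language.ElementaryEmbedding L M carrier _ str

/-- A family of formulas `φs i (x, aₛ i)` (with parameters substituted for the `β`-variables) is
consistent: it is realized in some elementary extension of `M` (equivalently, it is finitely
satisfiable). -/
def Consistent {L : FirstOrder.Language.{u, u}} {M : Type u} [L.Structure M] {α β : Type} {ι : Type v}
    (φs : ι → L.Formula (α ⊕ β)) (as : ι → β → M) : Prop :=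
  ∃ E : ElemExtension L M,
    letI := E.str
    ∃ x : α → E.carrier, ∀ i, Formula.Realize (φs i) (Sum.elim x fun j => E.emb.toFun (as i j))

/-- `(a i)_{i ∈ I}` is an `I`-indexed indiscernible family of `β`-tuples in `M`. -/
def IndexedIndiscernible (L' : FirstOrder.Language.{u, u}) (I : Type u) [L'.Structure I]
    {L : FirstOrder.Language.{u, u}} {M : Type u} [L.Structure M] {β : Type} (a : I → β → M) : Prop :=
  ∀ (n : ℕ) (t s : Fin n → I), qfTypeEq L' t s →
    ∀ φ : L.Formula (Fin n × β),
      (Formula.Realize φ fun p => a (t p.1) p.2) ↔ Formula.Realize φ fun p => a (s p.1) p.2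

/-- `(a i)_{i ∈ I}` is an `I`-indexed indiscernible family of `β`-tuples in `M`, over the
parameter set `Cset`. -/
def IndexedIndiscernibleOver (L' : FirstOrder.Language.{u, u}) (I : Type u) [L'.Structure I]
    {L : FirstOrder.Language.{u, u}} {M : Type u} [L.Structure M] {β : Type}
    (Cset : Set M) (a : I → β → M) : Prop :=
  ∀ (n k : ℕ) (t s : Fin n → I) (c : Fin k → M), (∀ j, c j ∈ Cset) → qfTypeEq L' t s →
    ∀ φ : L.Formula (Fin n × β ⊕ Fin k),
      (Formula.Realize φ (Sum.elim (fun p => a (t p.1) p.2) c) ↔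
        Formula.Realize φ (Sum.elim (fun p => a (s p.1) p.2) c))

/-- The family `(b j)_{j ∈ J}` (in `N`) is locally based on the family `(a i)_{i ∈ I}` (in `M`):
for every finite set `Δ` of formulas and finite tuple `t` of indices from `J` there is a tuple `s`
of indices from `I` with the same complete quantifier-free type such that the `Δ`-types match. -/
def LocallyBased (L' : FirstOrder.Language.{u, u}) {J I : Type u} [L'.Structure J] [L'.Structure I]
    {L : FirstOrder.Language.{u, u}} {M N : Type u} [L.Structure M] [L.Structure N] {β : Type}
    (b : J → β → N) (a : I → β → M) : Prop :=
  ∀ (n : ℕ) (Δ : Set (L.Formula (Fin n × β))), Δ.Finite → ∀ t : Fin n → J,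
    ∃ s : Fin n → I, qfTypeEq L' t s ∧
      ∀ φ ∈ Δ, ((Formula.Realize φ fun p => b (t p.1) p.2) ↔
        Formula.Realize φ fun p => a (s p.1) p.2)

/-- `I`-indexed indiscernibles have the modeling property: every `I`-indexed family of tuples in
any structure `M` admits an `I`-indexed indiscernible family, in some elementary extension of `M`,
locally based on it. -/
def ModelingProperty (L' : FirstOrder.Language.{u, u}) (I : Type u) [L'.Structure I] : Prop :=
  ∀ (L : FirstOrder.Language.{u, u}) (M : Type u) (S : L.Structure M),
    letI := S
    ∀ (β : Type) (a : I → β → M),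
      ∃ E : ElemExtension L M,
        letI := E.str
        ∃ b : I → β → E.carrier,
          IndexedIndiscernible (L := L) L' I b ∧
            LocallyBased (L := L) L' b fun i x => E.emb.toFun (a i x)

/-- A Ramsey index structure: a locally finite structure with a relation symbol interpreted as a
linear (strict total) order, whose indexed indiscernibles have the modeling property. -/
def IsRamseyIndex (L' : FirstOrder.Language.{u, u}) (I : Type u) [L'.Structure I]
    (lt : L'.Relations 2) : Prop :=
  IsStrictTotalOrder I (fun a b => Structure.RelMap lt ![a, b]) ∧
  (∀ s : Set I, s.Finite →
    Set.Finite ((Substructure.closure L' s : L'.Substructure I) : Set I)) ∧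
  ModelingProperty L' I

/-! ### Colored linear orders -/

/-- The language of `κ`-colored linear orders: a binary order relation and a unary predicate for
each color in `κ`. -/
def colLang (κ : Type u) : FirstOrder.Language.{u, u} where
  Functions := fun _ => PEmpty
  Relations := fun n =>
    match n with
    | 1 => κ
    | 2 => PUnit
    | _ => PEmpty

/-- The order symbol of the colored linear order language. -/
def ltSym (κ : Type u) : (colLang κ).Relations 2 := PUnit.unit

/-- The color predicates of the colored linear order language. -/
def colSym {κ : Type u} (c : κ) : (colLang κ).Relations 1 := c

/-- The order of a structure in the colored linear order language. -/
def cLT (κ : Type u) {C : Type u} [(colLang κ).Structure C] (x y : C) : Prop :=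
  Structure.RelMap (ltSym κ) ![x, y]

/-- `x` has color `c` in a structure for the colored linear order language. -/
def HasColor (κ : Type u) {C : Type u} [(colLang κ).Structure C] (c : κ) (x : C) : Prop :=
  Structure.RelMap (colSym c) ![x]

/-- `C` is (up to isomorphism) the colored linear order `c_κ`, i.e. the Fraïssé limit of the class
of finite linear orders whose domain is partitioned into colors from `κ`: it is a countable,
ultrahomogeneous, colored linear order into which every finite `κ`-colored linear order embeds. -/
structure IsColoredLimit (κ C : Type u) [(colLang κ).Structure C] : Prop where
  strict : IsStrictTotalOrder C (cLT κ)
  partition : ∀ x : C, ∃! c : κ, HasColor κ c x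
  countable : Countable C
  ageFull : ∀ (n : ℕ) (pat : Fin n → κ), ∃ f : Fin n → C,
    (∀ i j : Fin n, i < j → cLT κ (f i) (f j)) ∧ ∀ i, HasColor κ (pat i) (f i)
  ultrahomogeneous : ∀ (n : ℕ) (s t : Fin n → C), qfTypeEq (colLang κ) s t →
    ∃ g : C ≃[colLang κ] C, ∀ i, g (s i) = t i

/-! ### Tree properties -/

/-- The family of formulas `φ (x, f i)`, indexed by `i ∈ C`, is `q`-inconsistent, where the
complete quantifier-free type `q` is represented by a tuple realizing it in `C`: whenever a tuple
`t` of indices realizes `q`, the corresponding finite set of formulas is inconsistent. -/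
def QInconsistent (L' : FirstOrder.Language.{u, u}) {C : Type u} [L'.Structure C]
    {L : FirstOrder.Language.{u, u}} {M : Type u} [L.Structure M] {α β : Type} {k : ℕ}
    (φ : L.Formula (α ⊕ β)) (q : Fin k → C) (f : C → β → M) : Prop :=
  ∀ t : Fin k → C, qfTypeEq L' q t →
    ¬ Consistent (fun _ : Fin k => φ) fun j => f (t j)

/-- `φ` has the `I`-tree property witnessed by the complete quantifier-free type of the tuple `q`:
there is a tree of parameters indexed by `I^{<ω}` all of whose branches are consistent and all of
whose families of immediate successors are `q`-inconsistent. -/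
def HasITPWith (L' : FirstOrder.Language.{u, u}) (C : Type u) [L'.Structure C]
    {L : FirstOrder.Language.{u, u}} {M : Type u} [L.Structure M] {α β : Type} {k : ℕ}
    (φ : L.Formula (α ⊕ β)) (q : Fin k → C) : Prop :=
  ∃ a : List C → β → M,
    (∀ b : ℕ → C, Consistent (fun _ : ℕ => φ) fun n => a (List.ofFn fun i : Fin n => b i)) ∧
    (∀ η : List C, QInconsistent L' φ q fun i => a (η ++ [i]))

/-- `φ` has the `I`-tree property (`I`-TP), for the index structure `C`. -/
def HasITP (L' : FirstOrder.Language.{u, u}) (C : Type u) [L'.Structure C]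
    {L : FirstOrder.Language.{u, u}} {M : Type u} [L.Structure M] {α β : Type}
    (φ : L.Formula (α ⊕ β)) : Prop :=
  ∃ (k : ℕ) (q : Fin k → C), HasITPWith L' C (M := M) φ q

/-- `φ` has `I`-TP₂ witnessed by the complete quantifier-free type of the tuple `q`: there is an
array of parameters, with rows indexed by `C`, such that all paths are consistent while every row
is `q`-inconsistent. -/
def HasITP2With (L' : FirstOrder.Language.{u, u}) (C : Type u) [L'.Structure C]
    {L : FirstOrder.Language.{u, u}} {M : Type u} [L.Structure M] {α β : Type} {k : ℕ}
    (φ : L.Formula (α ⊕ β)) (q : Fin k → C) : Prop :=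
  ∃ a : ℕ → C → β → M,
    (∀ f : ℕ → C, Consistent (fun _ : ℕ => φ) fun i => a i (f i)) ∧
    (∀ i : ℕ, QInconsistent L' φ q (a i))

/-- `φ` has `I`-TP₂, for the index structure `C`. -/
def HasITP2 (L' : FirstOrder.Language.{u, u}) (C : Type u) [L'.Structure C]
    {L : FirstOrder.Language.{u, u}} {M : Type u} [L.Structure M] {α β : Type}
    (φ : L.Formula (α ⊕ β)) : Prop :=
  ∃ (k : ℕ) (q : Fin k → C), HasITP2With L' C (M := M) φ q

/-- The classical tree property: a tree of parameters indexed by `ω^{<ω}` with consistent branches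
and `k`-inconsistent siblings. -/
def HasTP {L : FirstOrder.Language.{u, u}} {M : Type u} [L.Structure M] {α β : Type}
    (φ : L.Formula (α ⊕ β)) : Prop :=
  ∃ (a : List ℕ → β → M) (k : ℕ), 0 < k ∧
    (∀ b : ℕ → ℕ, Consistent (fun _ : ℕ => φ) fun n => a (List.ofFn fun i : Fin n => b i)) ∧
    (∀ (η : List ℕ) (t : Fin k → ℕ), Function.Injective t →
      ¬ Consistent (fun _ : Fin k => φ) fun j => a (η ++ [t j]))

/-- The classical tree property of the first kind (TP₁): a tree of parameters indexed by `ω^{<ω}`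
in which all initial segments of nodes are consistent and any `k` pairwise incomparable nodes are
inconsistent. -/
def HasTP1 {L : FirstOrder.Language.{u, u}} {M : Type u} [L.Structure M] {α β : Type}
    (φ : L.Formula (α ⊕ β)) : Prop :=
  ∃ (a : List ℕ → β → M) (k : ℕ), 0 < k ∧
    (∀ η : List ℕ, Consistent (fun i : Fin (η.length + 1) => φ) fun i => a (η.take i)) ∧
    (∀ t : Fin k → List ℕ, (∀ i j, i ≠ j → ¬ t i <+: t j) →
      ¬ Consistent (fun _ : Fin k => φ) fun j => a (t j))

/-- The conjunction `ψ (x; y₀, …, y_{c-1}) = ⋀_{i<c} φ (x, yᵢ)` of `c` instances of `φ` has TP₁;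
the parameters of `ψ` are organized as `c`-tuples of `β`-tuples. -/
def ConjHasTP1 {L : FirstOrder.Language.{u, u}} {M : Type u} [L.Structure M] {α β : Type}
    (φ : L.Formula (α ⊕ β)) (c : ℕ) : Prop :=
  ∃ (a : List ℕ → Fin c → β → M) (k : ℕ), 0 < k ∧
    (∀ η : List ℕ, Consistent (fun p : Fin (η.length + 1) × Fin c => φ)
      fun p => a (η.take p.1) p.2) ∧
    (∀ t : Fin k → List ℕ, (∀ i j, i ≠ j → ¬ t i <+: t j) →
      ¬ Consistent (fun _ : Fin k × Fin c => φ) fun p => a (t p.1) p.2)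

/-- The structure, in the language of `κ`-colored linear orders, on the tree of nodes `C^{<ω}`:
nodes are compared in the lexicographic order of the tree, and each node (other than the root)
carries the color of its last entry. -/
def nodeStructure (κ C : Type u) [(colLang κ).Structure C] :
    (colLang κ).Structure (List C) where
  funMap := fun {n} f _ => PEmpty.elim f
  RelMap := fun {n} =>
    match n with
    | 0 => fun r _ => PEmpty.elim r
    | 1 => fun c x => ∃ (η : List C) (i : C), x 0 = η ++ [i] ∧ HasColor κ c i
    | 2 => fun _ x => List.Lex (cLT κ) (x 0) (x 1)
    | (_ + 3) => fun r _ => PEmpty.elim r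

/-- `φ` has c-TP₁ witnessed by the complete quantifier-free type of the tuple `q` from the colored
linear order `C`: there is a tree of parameters indexed by `C^{<ω}` in which all initial segments
of nodes are consistent, while any pairwise incomparable nodes whose quantifier-free type in the
language of `C` (nodes carrying the colors of their last entries, ordered lexicographically) is
`q` are inconsistent. -/
def HasCTP1With (κ C : Type u) [(colLang κ).Structure C]
    {L : FirstOrder.Language.{u, u}} {M : Type u} [L.Structure M] {α β : Type} {k : ℕ}
    (φ : L.Formula (α ⊕ β)) (q : Fin k → C) : Prop :=
  ∃ a : List C → β → M,
    (∀ η : List C, Consistent (fun i : Fin (η.length + 1) => φ) fun i => a (η.take i)) ∧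
    (∀ t : Fin k → List C, (∀ i j, i ≠ j → ¬ t i <+: t j) →
      (letI := nodeStructure κ C; qfTypeEq (colLang κ) q t) →
      ¬ Consistent (fun _ : Fin k => φ) fun j => a (t j))

/-- `φ` has c-TP₁, for the colored linear order `C`. -/
def HasCTP1 (κ C : Type u) [(colLang κ).Structure C]
    {L : FirstOrder.Language.{u, u}} {M : Type u} [L.Structure M] {α β : Type}
    (φ : L.Formula (α ⊕ β)) : Prop :=
  ∃ (k : ℕ) (q : Fin k → C), HasCTP1With κ C (M := M) φ q

/-! ### Stability, IP, and order indiscernibles -/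

/-- `φ (x, y)` is unstable (has the order property). -/
def HasOrderProperty {L : FirstOrder.Language.{u, u}} {M : Type u} [L.Structure M] {α β : Type}
    (φ : L.Formula (α ⊕ β)) : Prop :=
  ∃ (a : ℕ → α → M) (b : ℕ → β → M),
    ∀ i j : ℕ, Formula.Realize φ (Sum.elim (a i) (b j)) ↔ i < j

/-- `(a i)_{i<ω}` is an indiscernible sequence of `γ`-tuples. -/
def OrderIndiscernible {L : FirstOrder.Language.{u, u}} {M : Type u} [L.Structure M] {γ : Type}
    (a : ℕ → γ → M) : Prop :=
  ∀ (n : ℕ) (t s : Fin n → ℕ), StrictMono t → StrictMono s →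
    ∀ φ : L.Formula (Fin n × γ),
      (Formula.Realize φ fun p => a (t p.1) p.2) ↔ Formula.Realize φ fun p => a (s p.1) p.2

/-- `φ (x, y)` has the independence property: there is an indiscernible sequence `(a i)` such that
`{φ (x, aᵢ) : i even} ∪ {¬ φ (x, aᵢ) : i odd}` is consistent. -/
def HasIP {L : FirstOrder.Language.{u, u}} {M : Type u} [L.Structure M] {α β : Type}
    (φ : L.Formula (α ⊕ β)) : Prop :=
  ∃ a : ℕ → β → M, OrderIndiscernible (L := L) a ∧
    ∃ E : ElemExtension L M,
      letI := E.str
      ∃ x : α → E.carrier, ∀ i : ℕ,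
        (Even i → Formula.Realize φ (Sum.elim x fun j => E.emb.toFun (a i j))) ∧
        (¬ Even i → ¬ Formula.Realize φ (Sum.elim x fun j => E.emb.toFun (a i j)))

/-- The conjunction `ψ (x; y₀, …, y_{c-1}) = ⋀_{i<c} φ (x, yᵢ)` of `c` instances of `φ` has the
independence property; the parameters of `ψ` are organized as `c`-tuples of `β`-tuples. -/
def ConjHasIP {L : FirstOrder.Language.{u, u}} {M : Type u} [L.Structure M] {α β : Type}
    (φ : L.Formula (α ⊕ β)) (c : ℕ) : Prop :=
  ∃ a : ℕ → Fin c → β → M, OrderIndiscernible (L := L) (fun i (p : Fin c × β) => a i p.1 p.2) ∧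
    ∃ E : ElemExtension L M,
      letI := E.str
      ∃ x : α → E.carrier, ∀ i : ℕ,
        (Even i → ∀ m : Fin c, Formula.Realize φ (Sum.elim x fun j => E.emb.toFun (a i m j))) ∧
        (¬ Even i → ∃ m : Fin c, ¬ Formula.Realize φ (Sum.elim x fun j => E.emb.toFun (a i m j)))

/-! ### Generalized dividing and local character -/

/-- `φ (x, c)` `I`-divides over the set `B`: there is an `I`-indexed family of tuples,
indiscernible over `B`, containing `c`, such that the corresponding family of instances of `φ`
is inconsistent. -/
def FormulaDividesOver (L' : FirstOrder.Language.{u, u}) (C : Type u) [L'.Structure C]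
    {L : FirstOrder.Language.{u, u}} {M : Type u} [L.Structure M] {α β : Type}
    (φ : L.Formula (α ⊕ β)) (c : β → M) (B : Set M) : Prop :=
  ∃ (f : C → β → M) (j₀ : C), IndexedIndiscernibleOver (L := L) L' C B f ∧ f j₀ = c ∧
    ¬ Consistent (fun _ : C => φ) f

/-- `(a i)` is a `q`-inconsistent `I`-dividing chain for `φ`: the instances `φ (x, a i)` are
jointly consistent, and each `φ (x, a i)` `I`-divides over the earlier elements of the chain,
witnessed by an indiscernible family that is `q`-inconsistent for the single fixed complete
quantifier-free type represented by the tuple `q`. -/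
def QIncDividingChain (L' : FirstOrder.Language.{u, u}) (C : Type u) [L'.Structure C]
    {L : FirstOrder.Language.{u, u}} {M : Type u} [L.Structure M] {α β : Type}
    (φ : L.Formula (α ⊕ β)) {k : ℕ} (q : Fin k → C) {J : Type v} [LinearOrder J]
    (a : J → β → M) : Prop :=
  Consistent (fun _ : J => φ) a ∧
  ∀ i : J, ∃ (f : C → β → M) (j₀ : C),
    IndexedIndiscernibleOver (L := L) L' C {m : M | ∃ j x, j < i ∧ m = a j x} f ∧
    f j₀ = a i ∧ QInconsistent L' φ q f ∧ ¬ Consistent (fun _ : C => φ) f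

/-- `p` is a complete type over `A` in the variables `α`, presented as a set of formulas paired
with their parameter tuples: all parameters come from `A`, `p` is finitely satisfiable, and `p`
decides every formula with parameters in `A`. -/
def IsCompleteTypeOver (L : FirstOrder.Language.{u, u}) (M : Type u) [L.Structure M] (A : Set M)
    (α : Type) (p : Set (Σ k : ℕ, L.Formula (α ⊕ Fin k) × (Fin k → M))) : Prop :=
  (∀ ψ ∈ p, ∀ j, ψ.2.2 j ∈ A) ∧
  (∀ S ⊆ p, S.Finite →
    ∃ E : ElemExtension L M,
      letI := E.str
      ∃ x : α → E.carrier, ∀ ψ ∈ S,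
        Formula.Realize ψ.2.1 (Sum.elim x fun j => E.emb.toFun (ψ.2.2 j))) ∧
  (∀ (k : ℕ) (φ : L.Formula (α ⊕ Fin k)) (c : Fin k → M), (∀ j, c j ∈ A) →
    (⟨k, φ, c⟩ ∈ p ∨ ⟨k, BoundedFormula.not φ, c⟩ ∈ p))

/-- The type `p` `I`-divides over the set `B` if some formula in it does. -/
def TypeDividesOver (L' : FirstOrder.Language.{u, u}) (C : Type u) [L'.Structure C]
    {L : FirstOrder.Language.{u, u}} {M : Type u} [L.Structure M] {α : Type}
    (p : Set (Σ k : ℕ, L.Formula (α ⊕ Fin k) × (Fin k → M))) (B : Set M) : Prop :=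
  ∃ ψ ∈ p, FormulaDividesOver L' C ψ.2.1 ψ.2.2 B

/-- Equality of complete quantifier-free types is an equivalence relation on `n`-tuples. -/
def qfSetoid (L' : FirstOrder.Language.{u, u}) (C : Type u) [L'.Structure C] (n : ℕ) :
    Setoid (Fin n → C) :=
  ⟨fun t s => qfTypeEq L' t s,
    fun _ _ _ => Iff.rfl,
    fun h φ hφ => (h φ hφ).symm,
    fun h₁ h₂ φ hφ => (h₁ φ hφ).trans (h₂ φ hφ)⟩

/-- The number of complete quantifier-free types of `C` in finitely many variables. -/
def numQfTypes (L' : FirstOrder.Language.{u, u}) (C : Type u) [L'.Structure C] : Cardinal.{u} :=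
  #(Σ n : ℕ, Quotient (qfSetoid L' C n))

/-- `I`-dividing has local character (for the complete theory of `M`): every complete type over
any set `A` fails to `I`-divide over some subset of `A` of size at most `|T| + κ`, where `κ` is
the number of complete quantifier-free types of the index structure in finitely many variables. -/
def LocalChar (L : FirstOrder.Language.{u, u}) (M : Type u) [L.Structure M]
    (L' : FirstOrder.Language.{u, u}) (C : Type u) [L'.Structure C] : Prop :=
  ∀ (α : Type) (A : Set M) (p : Set (Σ k : ℕ, L.Formula (α ⊕ Fin k) × (Fin k → M))),
    IsCompleteTypeOver L M A α p →
    ∃ B : Set M, B ⊆ A ∧ #B ≤ Language.card L + ℵ₀ + numQfTypes L' C ∧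
      ¬ TypeDividesOver L' C p B

/-! ### Monster models -/

/-- `M` is `κ̄`-saturated: every finitely satisfiable family of formulas whose parameters form a
set of size `< κ̄` is realized in `M`. -/
def Saturated (L : FirstOrder.Language.{u, u}) (M : Type u) [L.Structure M]
    (κbar : Cardinal.{u}) : Prop :=
  ∀ (α : Type) (ι : Type u) (ks : ι → ℕ) (φs : ∀ i, L.Formula (α ⊕ Fin (ks i)))
    (as : ∀ i, Fin (ks i) → M),
    #(⋃ i, Set.range (as i)) < κbar →
    (∀ s : Set ι, s.Finite → ∃ x : α → M, ∀ i ∈ s, Formula.Realize (φs i) (Sum.elim x (as i))) →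
    ∃ x : α → M, ∀ i, Formula.Realize (φs i) (Sum.elim x (as i))

/-- `M` is a monster model (relative to the bound `κ̄`): it is infinite, `κ̄`-saturated, and `κ̄`
is an uncountable strong limit. -/
def IsMonster (L : FirstOrder.Language.{u, u}) (M : Type u) [L.Structure M]
    (κbar : Cardinal.{u}) : Prop :=
  Infinite M ∧ Saturated L M κbar ∧ ℵ₀ < κbar ∧
    ∀ μ : Cardinal.{u}, μ < κbar → 2 ^ μ < κbar

/-! ### Maps between colored linear order languages -/

/-- Two tuples in structures of two different languages related by a language morphism have
corresponding quantifier-free types. -/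
def qfTypeEqAlong {L₁ L₂ : FirstOrder.Language.{u, u}} (Φ : L₁ →ᴸ L₂) {A B : Type u}
    [L₁.Structure A] [L₂.Structure B] {n : ℕ} (t : Fin n → A) (s : Fin n → B) : Prop :=
  ∀ φ : L₁.Formula (Fin n), BoundedFormula.IsQF φ →
    (Formula.Realize φ t ↔ Formula.Realize (LHom.onFormula Φ φ) s)

/-- The morphism of colored linear order languages induced by a map of colors. -/
def colMap {σ τ : Type u} (i : σ → τ) : colLang σ →ᴸ colLang τ where
  onFunction := fun {_} f => PEmpty.elim f
  onRelation := fun {n} =>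
    match n with
    | 0 => fun r => PEmpty.elim r
    | 1 => fun c => i c
    | 2 => fun r => r
    | (_ + 3) => fun r => PEmpty.elim r

/-! ### Generalized tree and array index structures -/

/-- The relational version `L'ᵣ` of a language `L'`: every `n`-ary function symbol is replaced by
an `(n+1)`-ary relation symbol. -/
def relationalize (L' : FirstOrder.Language.{u, u}) : FirstOrder.Language.{u, u} where
  Functions := fun _ => PEmpty
  Relations := fun n =>
    match n with
    | 0 => L'.Relations 0
    | (m + 1) => L'.Relations (m + 1) ⊕ L'.Functions m

/-- Interpret the relationalized language `L'ᵣ` on a type `A` that contains disjoint copies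
`emb b : I → A` of the `L'`-structure `I`: relations (and graphs of functions) hold only within a
single copy, where they are computed in `I`. -/
def relationalizeStructure (L' : FirstOrder.Language.{u, u}) {I A B : Type u} [L'.Structure I]
    (emb : B → I → A) : (relationalize L').Structure A where
  funMap := fun {_} f _ => PEmpty.elim f
  RelMap := fun {n} =>
    match n with
    | 0 => fun r _ => Structure.RelMap (L := L') (M := I) r fun j : Fin 0 => j.elim0
    | (m + 1) => fun r x =>
      match r with
      | Sum.inl r => ∃ (b : B) (ids : Fin (m + 1) → I),
          (∀ j, x j = emb b (ids j)) ∧ Structure.RelMap (M := I) r ids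
      | Sum.inr f => ∃ (b : B) (ids : Fin (m + 1) → I),
          (∀ j, x j = emb b (ids j)) ∧
            Structure.funMap (M := I) f (fun j : Fin m => ids j.castSucc) = ids (Fin.last m)

/-- The base language of trees: the tree partial order `⊴`, the lexicographic order `<ₗₑₓ`, and
the binary meet function `∧`. -/
def treeBase : FirstOrder.Language.{u, u} where
  Functions := fun n =>
    match n with
    | 2 => PUnit.{u + 1}
    | _ => PEmpty.{u + 1}
  Relations := fun n =>
    match n with
    | 2 => (PUnit.{u + 1} ⊕ PUnit.{u + 1} : Type u)
    | _ => PEmpty.{u + 1}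

/-- The longest common prefix (meet) of two finite sequences. -/
noncomputable def lcp {I : Type u} : List I → List I → List I
  | a :: as, b :: bs => if Classical.propDecidable (a = b) |>.decide then a :: lcp as bs else []
  | _, _ => []

/-- The base tree structure on `I^{<ω}`: `⊴` is the prefix (tree) order, `<ₗₑₓ` the lexicographic
order induced by the order `r` on `I`, and `∧` the longest common prefix. -/
noncomputable def treeBaseStructure (I : Type u) (r : I → I → Prop) :
    treeBase.Structure (List I) where
  funMap := fun {n} f x =>
    match n, f with
    | 0, f => PEmpty.elim f
    | 1, f => PEmpty.elim f
    | 2, _ => lcp (x 0) (x 1)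
    | (_ + 3), f => PEmpty.elim f
  RelMap := fun {n} R x =>
    match n, R with
    | 0, R => PEmpty.elim R
    | 1, R => PEmpty.elim R
    | 2, Sum.inl _ => x 0 <+: x 1
    | 2, Sum.inr _ => List.Lex r (x 0) (x 1)
    | (_ + 3), R => PEmpty.elim R

/-- The language of level predicates `P_α` for `α < ω`. -/
def levelLang : FirstOrder.Language.{u, u} where
  Functions := fun _ => PEmpty
  Relations := fun n =>
    match n with
    | 1 => ULift ℕ
    | _ => PEmpty

/-- The interpretation of the level predicates on a tree `I^{<ω}`: `P_α` holds of exactly the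
nodes of length `α`. -/
def levelStructure (I : Type u) : levelLang.Structure (List I) where
  funMap := fun {_} f _ => PEmpty.elim f
  RelMap := fun {n} R x =>
    match n, R with
    | 1, m => (x 0).length = m.down

/-- The language `L_{0,I}` for trees over the index structure `I`. -/
def treeLang0 (L' : FirstOrder.Language.{u, u}) : FirstOrder.Language.{u, u} :=
  treeBase.sum (relationalize L')

/-- The language `L_{s,ω,I}` for trees of height `ω` over the index structure `I`. -/
def treeLangS (L' : FirstOrder.Language.{u, u}) : FirstOrder.Language.{u, u} :=
  (treeLang0 L').sum levelLang

/-- The `L_{0,I}`-structure on the tree `I^{<ω}`, where the set of immediate successors of any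
node is a copy of `I`. -/
noncomputable def treeStructure0 (L' : FirstOrder.Language.{u, u}) (I : Type u) [L'.Structure I]
    (lt : L'.Relations 2) : (treeLang0 L').Structure (List I) :=
  letI := treeBaseStructure I fun a b => Structure.RelMap lt ![a, b]
  letI := relationalizeStructure L' fun (η : List I) (i : I) => η ++ [i]
  inferInstanceAs ((treeBase.sum (relationalize L')).Structure (List I))

/-- The `L_{s,ω,I}`-structure on the tree `I^{<ω}`. -/
noncomputable def treeStructureS (L' : FirstOrder.Language.{u, u}) (I : Type u) [L'.Structure I]
    (lt : L'.Relations 2) : (treeLangS L').Structure (List I) :=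
  letI := treeStructure0 L' I lt
  letI := levelStructure I
  inferInstanceAs (((treeLang0 L').sum levelLang).Structure (List I))

/-- The base language of arrays: a linear order and an equivalence relation. -/
def arrayBase : FirstOrder.Language.{u, u} where
  Functions := fun _ => PEmpty
  Relations := fun n =>
    match n with
    | 2 => (PUnit.{u + 1} ⊕ PUnit.{u + 1} : Type u)
    | _ => PEmpty.{u + 1}

/-- The convexly ordered equivalence relation on `K × I` whose classes are the rows
`{α} × I`. -/
def arrayBaseStructure (K I : Type u) [LinearOrder K] (r : I → I → Prop) :
    arrayBase.Structure (K × I) where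
  funMap := fun {_} f _ => PEmpty.elim f
  RelMap := fun {n} R x =>
    match n, R with
    | 0, R => PEmpty.elim R
    | 1, R => PEmpty.elim R
    | 2, Sum.inl _ => (x 0).1 < (x 1).1 ∨ ((x 0).1 = (x 1).1 ∧ r (x 0).2 (x 1).2)
    | 2, Sum.inr _ => (x 0).1 = (x 1).1
    | (_ + 3), R => PEmpty.elim R

/-- The language of `I`-arrays: a convexly ordered equivalence relation together with the
relational version of the language of `I`. -/
def arrayLang (L' : FirstOrder.Language.{u, u}) : FirstOrder.Language.{u, u} :=
  arrayBase.sum (relationalize L')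

/-- The structure of a convexly ordered equivalence relation on `K × I` whose classes are the
copies `{α} × I` of `I` (with functions of `I` replaced by their graphs on each copy). -/
def arrayStructure (L' : FirstOrder.Language.{u, u}) (K I : Type u) [LinearOrder K]
    [L'.Structure I] (lt : L'.Relations 2) : (arrayLang L').Structure (K × I) :=
  letI := arrayBaseStructure K I fun a b => Structure.RelMap lt ![a, b]
  letI := relationalizeStructure L' fun (k : K) (i : I) => (k, i)
  inferInstanceAs ((arrayBase.sum (relationalize L')).Structure (K × I))

/-- A `K × I`-array of tuples is mutually `I`-indiscernible: each row is an `I`-indexed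
indiscernible family over the entries of all the other rows. -/
def MutuallyIndiscernible (L' : FirstOrder.Language.{u, u}) (I : Type u) [L'.Structure I]
    {L : FirstOrder.Language.{u, u}} {M : Type u} [L.Structure M] {K : Type u} {β : Type}
    (a : K → I → β → M) : Prop :=
  ∀ i : K, IndexedIndiscernibleOver (L := L) L' I
    {m : M | ∃ k j x, k ≠ i ∧ m = a k j x} (a i)

/-- A `K × I`-array of tuples is strongly `I`-indiscernible: it is mutually `I`-indiscernible and
the sequence of its rows is an indiscernible sequence. -/
def StronglyIndiscernibleArray (L' : FirstOrder.Language.{u, u}) (I : Type u) [L'.Structure I]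
    {L : FirstOrder.Language.{u, u}} {M : Type u} [L.Structure M] {K : Type u} [LinearOrder K]
    {β : Type} (a : K → I → β → M) : Prop :=
  MutuallyIndiscernible (L := L) L' I a ∧
  ∀ (n : ℕ) (t s : Fin n → K), StrictMono t → StrictMono s →
    ∀ φ : L.Formula (Fin n × (I × β)),
      ((Formula.Realize φ fun p => a (t p.1) p.2.1 p.2.2) ↔
        Formula.Realize φ fun p => a (s p.1) p.2.1 p.2.2)


section Comb
variable {X Y : Type*} (R : X → Y → Prop)

/-- Binary trees of height `h` with leaves in `P` and labels in `Q`. -/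
def BTree : ℕ → Set X → Set Y → Prop
  | 0, P, _ => P.Nonempty
  | h + 1, P, Q => ∃ y ∈ Q, BTree h {x ∈ P | R x y} Q ∧ BTree h {x ∈ P | ¬ R x y} Q

/-- `k`-branching trees of height `h` with inconsistent siblings, all branches realized in `P`. -/
def KTree (k : ℕ) : ℕ → Set X → Prop
  | 0, P => P.Nonempty
  | h + 1, P => ∃ y : Fin k → Y, (∀ x, ∃ j, ¬ R x (y j)) ∧ ∀ j, KTree k h {x ∈ P | R x (y j)}

variable {R}

theorem BTree.mono {h : ℕ} : ∀ {P P' : Set X} {Q Q' : Set Y}, P ⊆ P' → Q ⊆ Q' →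
    BTree R h P Q → BTree R h P' Q' := by
  induction h with
  | zero => intro P P' Q Q' hP hQ H; exact Set.Nonempty.mono hP H
  | succ h ih =>
    rintro P P' Q Q' hP hQ ⟨y, hy, h1, h2⟩
    exact ⟨y, hQ hy, ih (fun x hx => ⟨hP hx.1, hx.2⟩) hQ h1, ih (fun x hx => ⟨hP hx.1, hx.2⟩) hQ h2⟩

theorem KTree.mono {k h : ℕ} : ∀ {P P' : Set X}, P ⊆ P' → KTree R k h P → KTree R k h P' := by
  induction h with
  | zero => intro P P' hP H; exact Set.Nonempty.mono hP H
  | succ h ih =>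
    rintro P P' hP ⟨y, hy, h1⟩
    exact ⟨y, hy, fun j => ih (fun x hx => ⟨hP hx.1, hx.2⟩) (h1 j)⟩

theorem BTree.nonempty {h : ℕ} : ∀ {P : Set X} {Q : Set Y}, BTree R h P Q → P.Nonempty := by
  induction h with
  | zero => intro P Q H; exact H
  | succ h ih =>
    rintro P Q ⟨y, hy, h1, h2⟩
    exact (ih h1).mono (fun x hx => hx.1)

theorem KTree.antitone {k : ℕ} (hk : 0 < k) {m n : ℕ} (hmn : m ≤ n) {P : Set X}
    (H : KTree R k n P) : KTree R k m P := by
  induction hmn with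
  | refl => exact H
  | step _ ih =>
    obtain ⟨y, _, h1⟩ := H
    exact ih ((h1 ⟨0, hk⟩).mono (fun x hx => hx.1))

theorem BTree.ramsey (n : ℕ) : ∀ (m₁ m₂ : ℕ) (P : Set X) (Q Q₁ Q₂ : Set Y), m₁ + m₂ = n →
    Q ⊆ Q₁ ∪ Q₂ → BTree R n P Q → BTree R m₁ P Q₁ ∨ BTree R m₂ P Q₂ := by
  induction n with
  | zero =>
    intro m₁ m₂ P Q Q₁ Q₂ h hQ H
    obtain rfl : m₁ = 0 := by omega
    exact Or.inl H
  | succ n ih =>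
    intro m₁ m₂ P Q Q₁ Q₂ h hQ H
    rcases m₁ with _ | m₁
    · exact Or.inl H.nonempty
    rcases m₂ with _ | m₂
    · exact Or.inr H.nonempty
    obtain ⟨y, hy, h1, h2⟩ := H
    have s1 : {x ∈ P | R x y} ⊆ P := fun x hx => hx.1
    have s2 : {x ∈ P | ¬ R x y} ⊆ P := fun x hx => hx.1
    rcases hQ hy with hy1 | hy2
    · rcases ih m₁ (m₂ + 1) _ Q Q₁ Q₂ (by omega) hQ h1 with a | a
      · rcases ih m₁ (m₂ + 1) _ Q Q₁ Q₂ (by omega) hQ h2 with b | b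
        · exact Or.inl ⟨y, hy1, a, b⟩
        · exact Or.inr (b.mono s2 subset_rfl)
      · exact Or.inr (a.mono s1 subset_rfl)
    · rcases ih (m₁ + 1) m₂ _ Q Q₁ Q₂ (by omega) hQ h1 with a | a
      · exact Or.inl (a.mono s1 subset_rfl)
      · rcases ih (m₁ + 1) m₂ _ Q Q₁ Q₂ (by omega) hQ h2 with b | b
        · exact Or.inl (b.mono s2 subset_rfl)
        · exact Or.inr ⟨y, hy2, a, b⟩

theorem KTree.ramsey {k : ℕ} (m₁ : ℕ) : ∀ (m₂ : ℕ) (P P₁ P₂ : Set X),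
    P ⊆ P₁ ∪ P₂ → KTree R k (m₁ + m₂) P → KTree R k m₁ P₁ ∨ KTree R k m₂ P₂ := by
  induction m₁ with
  | zero =>
    intro m₂ P P₁ P₂ hP H
    by_cases h : P₁.Nonempty
    · exact Or.inl h
    · rw [Set.not_nonempty_iff_eq_empty] at h
      subst h
      rw [Nat.zero_add] at H
      exact Or.inr (H.mono (by simpa using hP))
  | succ m₁ ih =>
    intro m₂ P P₁ P₂ hP H
    rw [Nat.add_right_comm] at H
    obtain ⟨y, hy, h1⟩ := H
    by_cases h : KTree R k m₂ P₂
    · exact Or.inr h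
    · refine Or.inl ⟨y, hy, fun j => ?_⟩
      refine (ih m₂ _ {x ∈ P₁ | R x (y j)} P₂ ?_ (h1 j)).resolve_right h
      rintro x ⟨hx, hr⟩
      rcases hP hx with h | h
      · exact Or.inl ⟨h, hr⟩
      · exact Or.inr h

theorem KTree.ramsey_finset {k : ℕ} {J : Type*} [DecidableEq J] (m : ℕ) (Z : J → Set X)
    (s : Finset J) : ∀ P : Set X, (∀ x ∈ P, ∃ j ∈ s, x ∈ Z j) → KTree R k (s.card * m) P →
      ∃ j ∈ s, KTree R k m (P ∩ Z j) := by
  induction s using Finset.induction_on with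
  | empty =>
    intro P hP H
    simp only [Finset.card_empty, Nat.zero_mul] at H
    obtain ⟨x, hx⟩ := H
    obtain ⟨j, hj, _⟩ := hP x hx
    simp at hj
  | insert a s ha ih =>
    intro P hP H
    rw [Finset.card_insert_of_notMem ha, Nat.add_mul, Nat.one_mul, Nat.add_comm] at H
    have hcov : P ⊆ (P ∩ Z a) ∪ (P \ Z a) := by
      intro x hx
      by_cases h : x ∈ Z a
      · exact Or.inl ⟨hx, h⟩
      · exact Or.inr ⟨hx, h⟩
    rcases H.ramsey _ _ _ _ _ hcov with h | h
    · exact ⟨a, Finset.mem_insert_self _ _, h⟩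
    · obtain ⟨j, hj, hh⟩ := ih _ (by
        rintro x ⟨hx, hxa⟩
        obtain ⟨j, hj, hz⟩ := hP x hx
        rcases Finset.mem_insert.1 hj with rfl | hj
        · exact absurd hz hxa
        · exact ⟨j, hj, hz⟩) h
      exact ⟨j, Finset.mem_insert_of_mem hj, hh.mono (fun x hx => ⟨hx.1.1, hx.2⟩)⟩

theorem exists_bTree {k : ℕ} (hk : 0 < k) (d : ℕ) : ∀ P : Set X, (∀ m, KTree R k m P) →
    BTree R d P Set.univ := by
  have key : ∀ d : ℕ, ∃ m, ∀ P : Set X, KTree R k m P → BTree R d P Set.univ := by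
    intro d
    induction d with
    | zero => exact ⟨0, fun P H => H⟩
    | succ d ih =>
      obtain ⟨m, hm⟩ := ih
      refine ⟨k * m + 1, fun P H => ?_⟩
      have H' : KTree R k (k * m) P := H.antitone hk (Nat.le_succ _)
      obtain ⟨y, hy, h1⟩ := H
      obtain ⟨j, _, hj⟩ := KTree.ramsey_finset (R := R) m (fun j => {x | ¬ R x (y j)})
        (Finset.univ : Finset (Fin k)) P
        (fun x _ => by obtain ⟨j, hj⟩ := hy x; exact ⟨j, Finset.mem_univ _, hj⟩)
        (by simpa using H')
      refine ⟨y j, trivial, hm _ ((h1 j).antitone hk (Nat.le_mul_of_pos_left _ hk)), hm _ hj⟩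
  intro P hP
  obtain ⟨m, hm⟩ := key d
  exact hm P (hP m)

theorem exists_halfGraph (n : ℕ) : ∃ g : ℕ, ∀ (P : Set X) (Q : Set Y), BTree R g P Q →
    ∃ l : List (X × Y), l.length = n ∧ (∀ s ∈ l, s.1 ∈ P ∧ s.2 ∈ Q) ∧
      l.Pairwise (fun s t => R s.1 t.2 ∧ ¬ R t.1 s.2) := by
  induction n with
  | zero => exact ⟨0, fun P Q _ => ⟨[], by simp⟩⟩
  | succ n ih =>
    obtain ⟨g, hg⟩ := ih
    refine ⟨(g + 1) + (g + 1), fun P Q H => ?_⟩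
    obtain ⟨x, hx⟩ := H.nonempty
    have hcov : Q ⊆ {q ∈ Q | R x q} ∪ {q ∈ Q | ¬ R x q} := by
      intro q hq
      by_cases h : R x q
      · exact Or.inl ⟨hq, h⟩
      · exact Or.inr ⟨hq, h⟩
    rcases BTree.ramsey _ _ _ _ _ _ _ rfl hcov H with h | h
    · obtain ⟨y, hy, -, h2⟩ := h
      obtain ⟨l, hl, hmem, hpw⟩ := hg _ _ h2
      refine ⟨(x, y) :: l, by simp [hl], ?_, ?_⟩
      · intro s hs
        rcases List.mem_cons.1 hs with rfl | hs
        · exact ⟨hx, hy.1⟩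
        · exact ⟨(hmem s hs).1.1, (hmem s hs).2.1⟩
      · rw [List.pairwise_cons]
        exact ⟨fun t ht => ⟨(hmem t ht).2.2, (hmem t ht).1.2⟩, hpw⟩
    · obtain ⟨y, hy, h1, -⟩ := h
      obtain ⟨l, hl, hmem, hpw⟩ := hg _ _ h1
      refine ⟨l ++ [(x, y)], by simp [hl], ?_, ?_⟩
      · intro s hs
        rcases List.mem_append.1 hs with hs | hs
        · exact ⟨(hmem s hs).1.1, (hmem s hs).2.1⟩
        · rw [List.mem_singleton] at hs
          subst hs
          exact ⟨hx, hy.1⟩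
      · rw [List.pairwise_append]
        refine ⟨hpw, by simp, fun s hs t ht => ?_⟩
        rw [List.mem_singleton] at ht
        subst ht
        exact ⟨(hmem s hs).1.2, (hmem s hs).2.2⟩

/-- A tree with realized finite branches and inconsistent siblings gives finite half graphs. -/
theorem halfGraph_of_tree {k : ℕ} (a : List (Fin k) → Y)
    (hb : ∀ η : List (Fin k), ∃ x, ∀ i ≤ η.length, R x (a (η.take i)))
    (hs : ∀ (η : List (Fin k)) (x : X), ∃ j, ¬ R x (a (η ++ [j]))) (n : ℕ) :
    ∃ (x : ℕ → X) (y : ℕ → Y), ∀ i < n, ∀ j < n, (R (x i) (y j) ↔ i < j) := by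
  obtain ⟨x₀, -⟩ := hb []
  obtain ⟨j₀, -⟩ := hs [] x₀
  have hk : 0 < k := j₀.pos
  have hK : ∀ (m : ℕ) (η : List (Fin k)),
      KTree R k m {x | ∀ i ≤ η.length, R x (a (η.take i))} := by
    intro m
    induction m with
    | zero => exact fun η => hb η
    | succ m ih =>
      intro η
      refine ⟨fun j => a (η ++ [j]), hs η, fun j => (ih (η ++ [j])).mono ?_⟩
      intro x hx
      refine ⟨fun i hi => ?_, ?_⟩
      · have := hx i (by simp; omega)
        rwa [List.take_append_of_le_length hi] at this
      · have := hx (η ++ [j]).length le_rfl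
        rwa [List.take_length] at this
  obtain ⟨g, hg⟩ := exists_halfGraph (R := R) (2 * n + 1)
  obtain ⟨l, hl, -, hpw⟩ := hg _ _ (exists_bTree hk g _ (fun m => hK m []))
  rw [List.pairwise_iff_getElem] at hpw
  refine ⟨fun i => (l.getD (2 * i + 1) (x₀, a [])).1, fun j => (l.getD (2 * j) (x₀, a [])).2, ?_⟩
  intro i hi j hj
  have h1 : 2 * i + 1 < l.length := by omega
  have h2 : 2 * j < l.length := by omega
  beta_reduce
  rw [List.getD_eq_getElem _ _ h1, List.getD_eq_getElem _ _ h2]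
  rcases lt_or_ge i j with h | h
  · exact iff_of_true (hpw _ _ h1 h2 (by omega)).1 h
  · exact iff_of_false (hpw _ _ h2 h1 (by omega)).2 (by omega)

end Comb

section Model
variable {L : FirstOrder.Language.{u, u}} {M : Type u} [L.Structure M]

theorem exists_of_consistent {mx my : ℕ} {ι : Type v} (φ : L.Formula (Fin mx ⊕ Fin my))
    (as : ι → Fin my → M) (H : Consistent (fun _ => φ) as) (n : ℕ) (e : Fin n → ι) :
    ∃ x : Fin mx → M, ∀ i, φ.Realize (Sum.elim x (as (e i))) := by
  obtain ⟨E, x, hx⟩ := H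
  letI := E.str
  let ψ : L.Formula ((Fin n × Fin my) ⊕ Fin mx) := Formula.iInf fun i : Fin n =>
    φ.relabel (Sum.elim Sum.inr (fun v => Sum.inl (i, v)))
  have key := E.emb.map_formula (Formula.iExs (Fin mx) ψ) (fun p => as (e p.1) p.2)
  have h2 : (Formula.iExs (Fin mx) ψ).Realize (fun p : Fin n × Fin my => as (e p.1) p.2) := by
    rw [← key, Formula.realize_iExs]
    refine ⟨x, ?_⟩
    rw [Formula.realize_iInf]
    intro i
    rw [Formula.realize_relabel]
    convert hx (e i) using 1
    ext v
    rcases v with v | v <;> rfl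
  rw [Formula.realize_iExs] at h2
  obtain ⟨x', hx'⟩ := h2
  rw [Formula.realize_iInf] at hx'
  refine ⟨x', fun i => ?_⟩
  have := hx' i
  rw [Formula.realize_relabel] at this
  convert this using 1
  ext v
  rcases v with v | v <;> rfl

theorem consistent_of_exists {mx my : ℕ} {ι : Type v} (φ : L.Formula (Fin mx ⊕ Fin my))
    (as : ι → Fin my → M) (x : Fin mx → M) (hx : ∀ i, φ.Realize (Sum.elim x (as i))) :
    Consistent (fun _ => φ) as :=
  ⟨⟨M, inferInstance, ElementaryEmbedding.refl L M⟩, x, hx⟩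

theorem orderProperty_of_finite {κbar : Cardinal.{u}} (hM : IsMonster L M κbar) {mx my : ℕ}
    (φ : L.Formula (Fin mx ⊕ Fin my))
    (H : ∀ n : ℕ, ∃ (x : ℕ → Fin mx → M) (y : ℕ → Fin my → M), ∀ i < n, ∀ j < n,
      (φ.Realize (Sum.elim (x i) (y j)) ↔ i < j)) : HasOrderProperty (M := M) φ := by
  classical
  obtain ⟨-, hsat, hinf, -⟩ := hM
  let r : ℕ × ℕ → Fin mx ⊕ Fin my → (ℕ × (Fin mx ⊕ Fin my)) ⊕ Fin 0 := fun p =>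
    Sum.elim (fun v => Sum.inl (p.1, Sum.inl v)) (fun v => Sum.inl (p.2, Sum.inr v))
  let F : ULift.{u} (ℕ × ℕ) → L.Formula ((ℕ × (Fin mx ⊕ Fin my)) ⊕ Fin 0) := fun p =>
    if p.down.1 < p.down.2 then φ.relabel (r p.down) else (φ.relabel (r p.down)).not
  have hF : ∀ (p : ULift.{u} (ℕ × ℕ)) (z : ℕ × (Fin mx ⊕ Fin my) → M) (e : Fin 0 → M),
      (F p).Realize (Sum.elim z e) ↔
      (φ.Realize (Sum.elim (fun v => z (p.down.1, Sum.inl v)) (fun v => z (p.down.2, Sum.inr v)))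
        ↔ p.down.1 < p.down.2) := by
    intro p z e
    have hr : (φ.relabel (r p.down)).Realize (Sum.elim z e) ↔ φ.Realize
        (Sum.elim (fun v => z (p.down.1, Sum.inl v)) (fun v => z (p.down.2, Sum.inr v))) := by
      rw [Formula.realize_relabel]
      apply iff_of_eq
      congr 1
      ext v
      rcases v with v | v <;> rfl
    by_cases h : p.down.1 < p.down.2
    · simp only [F, if_pos h, hr, h, iff_true]
    · simp only [F, if_neg h, Formula.realize_not, hr, h, iff_false]
  obtain ⟨z, hz⟩ := hsat (ℕ × (Fin mx ⊕ Fin my)) (ULift.{u} (ℕ × ℕ)) (fun _ => 0) F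
    (fun _ => Fin.elim0) (by
      have : (⋃ _i : ULift.{u} (ℕ × ℕ), Set.range (Fin.elim0 : Fin 0 → M)) = ∅ := by simp
      rw [this, Cardinal.mk_emptyCollection]
      exact lt_of_le_of_lt zero_le hinf) (by
      intro s hs
      obtain ⟨N, hN⟩ : ∃ N, ∀ p ∈ s, p.down.1 < N ∧ p.down.2 < N := by
        obtain ⟨N, hN⟩ := (hs.image fun p => p.down.1 + p.down.2).bddAbove
        refine ⟨N + 1, fun p hp => ?_⟩
        have : p.down.1 + p.down.2 ≤ N := hN (Set.mem_image_of_mem _ hp)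
        omega
      obtain ⟨x, y, hxy⟩ := H N
      refine ⟨fun p => Sum.elim (x p.1) (y p.1) p.2, fun p hp => ?_⟩
      rw [hF]
      exact hxy _ (hN p hp).1 _ (hN p hp).2)
  refine ⟨fun i v => z (i, Sum.inl v), fun j v => z (j, Sum.inr v), fun i j => ?_⟩
  exact (hF ⟨(i, j)⟩ z _).1 (hz ⟨(i, j)⟩)

theorem orderProperty_of_ITP {κbar : Cardinal.{u}} (hM : IsMonster L M κbar)
    (L' : FirstOrder.Language.{u, u}) (C : Type u) [L'.Structure C] {mx my : ℕ}
    (φ : L.Formula (Fin mx ⊕ Fin my)) (H : HasITP L' C (M := M) φ) :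
    HasOrderProperty (M := M) φ := by
  obtain ⟨k, q, a, hbr, hq⟩ := H
  have hinf : Infinite M := hM.1
  have hs : ∀ (η : List (Fin k)) (x : Fin mx → M),
      ∃ j, ¬ φ.Realize (Sum.elim x (a ((η ++ [j]).map q))) := by
    intro η x
    by_contra! hcon
    refine hq (η.map q) q (fun _ _ => Iff.rfl) (consistent_of_exists φ _ x fun i => ?_)
    simpa using hcon i
  obtain ⟨m₀⟩ : Nonempty M := inferInstance
  obtain ⟨j₀, -⟩ := hs [] (fun _ => m₀)
  refine orderProperty_of_finite hM φ (halfGraph_of_tree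
    (R := fun (x : Fin mx → M) (y : Fin my → M) => φ.Realize (Sum.elim x y))
    (fun η => a (η.map q)) (fun η => ?_) hs)
  obtain ⟨x, hx⟩ := exists_of_consistent φ _ (hbr fun i => q (η.getD i j₀)) (η.length + 1)
    (fun i => (i : ℕ))
  refine ⟨x, fun i hi => ?_⟩
  have := hx ⟨i, by omega⟩
  have e : (List.ofFn fun t : Fin i => q (η.getD t j₀)) = (η.take i).map q := by
    apply List.ext_getElem
    · simp [hi]
    · intro t h1 h2
      have ht : t < η.length := by simp at h1; omega
      simp [ht]
  simp only [e] at this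
  exact this

end Model

/-- If a formula `φ` has the `c_κ`-tree property for some `κ ≥ 2`, then `φ` is
unstable (has the order property); consequently, every theory with c-TP is unstable. -/
theorem statement_12 (L : FirstOrder.Language.{u, u}) (M : Type u) [L.Structure M]
    (κbar : Cardinal.{u}) (hM : IsMonster L M κbar)
    (κ : Type u) [Nontrivial κ] (C : Type u) [(colLang κ).Structure C]
    (hC : IsColoredLimit κ C) (hbig : Language.card L + #C < κbar) :
    (∀ (mx my : ℕ) (φ : L.Formula (Fin mx ⊕ Fin my)),
      HasITP (colLang κ) C (M := M) φ → HasOrderProperty (M := M) φ) ∧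
    ((∃ (mx my : ℕ) (φ : L.Formula (Fin mx ⊕ Fin my)), HasITP (colLang κ) C (M := M) φ) →
      ∃ (mx my : ℕ) (φ : L.Formula (Fin mx ⊕ Fin my)), HasOrderProperty (M := M) φ) := by
  refine ⟨fun mx my φ h => orderProperty_of_ITP hM _ C φ h, ?_⟩
  rintro ⟨mx, my, φ, h⟩
  exact ⟨mx, my, φ, orderProperty_of_ITP hM _ C φ h⟩

end PaperTP
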